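/- Let d ≥ 1, r > 0, let ‖·‖ be a norm on ℝ^d with V_d the volume of its unit ball, let X have density f_X with h(X) finite and H(⌊X⌋) < ∞, and for each D > 0 let Z_D be independent of X with density f_{Z_D}(z) = (d/r)^{d/r−1}·(V_d·Γ(d/r)·D^{d/r})^{-1}·exp(−(d/(rD))‖z‖^r). Then liminf_{D↓0} { H(⌊X + Z_D⌋) − h(X + Z_D) } ≥ H(⌊X⌋) − h(X), where X + Z_D has density the convolution of f_X and f_{Z_D}. -/

import Mathlib

open MeasureTheory ProbabilityTheory Real Filter Topology
open scoped ENNReal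

/-- Componentwise integer part of a vector in ℝ^d. -/
noncomputable def intFloor (d : ℕ) (x : Fin d → ℝ) : Fin d → ℤ := fun i => ⌊x i⌋

/-- Discrete (Shannon) entropy, in nats, of the random element `V` under `P`,
valued in `[0,∞]`. -/
noncomputable def discEnt {Ω α : Type*} [MeasurableSpace Ω] (P : Measure Ω) (V : Ω → α) : ℝ≥0∞ :=
  ∑' a : α, ENNReal.ofReal (Real.negMulLog (P (V ⁻¹' {a})).toReal)

/-- Differential entropy of a measure on ℝ^d (w.r.t. Lebesgue measure),
as a Bochner integral of `-f log f` where `f` is the Radon–Nikodym density. -/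
noncomputable def diffEnt {d : ℕ} (μ : Measure (Fin d → ℝ)) : ℝ :=
  -∫ x, ((μ.rnDeriv volume x).toReal) * Real.log ((μ.rnDeriv volume x).toReal)

open Classical in
/-- Kullback–Leibler divergence of `μ` w.r.t. `ν`, valued in `[0,∞]`. -/
noncomputable def klDiv {α : Type*} [MeasurableSpace α] (μ ν : Measure α) : ℝ≥0∞ :=
  if μ ≪ ν ∧ Integrable (llr μ ν) μ then ENNReal.ofReal (∫ x, llr μ ν x ∂μ) else ⊤


section Auxiliary

variable {d : ℕ}

lemma measurable_intFloor : Measurable (intFloor d) :=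
  measurable_pi_lambda _ fun i => Int.measurable_floor.comp (measurable_pi_apply i)

lemma volume_intFloor_preimage (k : Fin d → ℤ) : volume (intFloor d ⁻¹' {k}) = 1 := by
  have : intFloor d ⁻¹' {k} = Set.pi Set.univ fun i => Set.Ico (k i : ℝ) (k i + 1) := by
    ext x
    simp [intFloor, funext_iff, Int.floor_eq_iff]
  rw [this, volume_pi_pi]
  simp

lemma lintegral_comp_intFloor (μ : Measure (Fin d → ℝ)) (G : (Fin d → ℤ) → ℝ≥0∞) :
    ∫⁻ x, G (intFloor d x) ∂μ = ∑' k, G k * μ (intFloor d ⁻¹' {k}) := by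
  rw [← lintegral_map (measurable_of_countable G) measurable_intFloor, lintegral_countable']
  simp_rw [Measure.map_apply measurable_intFloor (measurableSet_singleton _)]

lemma tendsto_lintegral_enorm_sub_translate {f : (Fin d → ℝ) → ℝ} (hf : Integrable f) :
    Tendsto (fun y => ∫⁻ x, ‖f (x - y) - f x‖ₑ) (𝓝 0) (𝓝 0) := by
  have hL : MemLp f 1 volume := memLp_one_iff_integrable.2 hf
  have : Fact ((1 : ℝ≥0∞) ≠ ⊤) := ⟨ENNReal.one_ne_top⟩
  have h1 : Tendsto (fun y : Fin d → ℝ => (DomAddAct.mk (-y)) +ᵥ hL.toLp f) (𝓝 0)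
      (𝓝 (DomAddAct.mk (-(0 : Fin d → ℝ)) +ᵥ hL.toLp f)) := by
    refine Tendsto.vadd ?_ tendsto_const_nhds
    exact (DomAddAct.continuous_mk.comp continuous_neg).tendsto 0
  rw [neg_zero, DomAddAct.mk_zero, zero_vadd, tendsto_iff_edist_tendsto_0] at h1
  refine h1.congr fun y => ?_
  rw [DomAddAct.mk_vadd_toLp, Lp.edist_toLp_toLp, eLpNorm_one_eq_lintegral_enorm]
  refine lintegral_congr fun x => ?_
  simp [neg_add_eq_sub]

/-- The average of the translates of `f` by `t • y`, weighted by `φ y`. -/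
noncomputable def mollify (φ f : (Fin d → ℝ) → ℝ) (t : ℝ) (x : Fin d → ℝ) : ℝ :=
  ∫ y, f (x - t • y) * φ y

lemma integrable_mollify_integrand {φ f : (Fin d → ℝ) → ℝ} (hφ : Integrable φ)
    (hφm : Measurable φ) (hf : Integrable f) (hfm : Measurable f) (t : ℝ) :
    Integrable (fun p : (Fin d → ℝ) × (Fin d → ℝ) => f (p.1 - t • p.2) * φ p.2)
      (volume.prod volume) := by
  rw [integrable_prod_iff' (by fun_prop)]
  refine ⟨ae_of_all _ fun y => (hf.comp_sub_right (t • y)).mul_const (φ y), ?_⟩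
  simp_rw [norm_mul, integral_mul_const, integral_sub_right_eq_self fun x => ‖f x‖]
  exact hφ.norm.const_mul _

lemma integrable_mollify {φ f : (Fin d → ℝ) → ℝ} (hφ : Integrable φ)
    (hφm : Measurable φ) (hf : Integrable f) (hfm : Measurable f) (t : ℝ) :
    Integrable (mollify φ f t) :=
  (integrable_mollify_integrand hφ hφm hf hfm t).integral_prod_left

lemma integral_mollify {φ f : (Fin d → ℝ) → ℝ} (hφ : Integrable φ)
    (hφm : Measurable φ) (hf : Integrable f) (hfm : Measurable f) (t : ℝ) :
    ∫ x, mollify φ f t x = (∫ x, f x) * ∫ y, φ y := by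
  unfold mollify
  rw [integral_integral_swap (integrable_mollify_integrand hφ hφm hf hfm t)]
  simp_rw [integral_mul_const, integral_sub_right_eq_self f, integral_const_mul]

lemma tendsto_lintegral_enorm_mollify_sub {φ f : (Fin d → ℝ) → ℝ} (hφ : Integrable φ)
    (hφm : Measurable φ) (hφ1 : ∫ y, φ y = 1) (hf : Integrable f) (hfm : Measurable f) :
    Tendsto (fun t => ∫⁻ x, ‖mollify φ f t x - f x‖ₑ) (𝓝 0) (𝓝 0) := by
  have hbound : ∀ t : ℝ, ∫⁻ x, ‖mollify φ f t x - f x‖ₑ ≤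
      ∫⁻ y, (∫⁻ x, ‖f (x - t • y) - f x‖ₑ) * ‖φ y‖ₑ := by
    intro t
    calc ∫⁻ x, ‖mollify φ f t x - f x‖ₑ
        ≤ ∫⁻ x, ∫⁻ y, ‖f (x - t • y) - f x‖ₑ * ‖φ y‖ₑ := by
          refine lintegral_mono_ae ?_
          filter_upwards [(integrable_mollify_integrand hφ hφm hf hfm t).prod_right_ae] with x hx
          have : mollify φ f t x - f x = ∫ y, (f (x - t • y) - f x) * φ y := by
            simp_rw [sub_mul]
            rw [integral_sub hx (hφ.const_mul _), integral_const_mul, hφ1, mul_one, mollify]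
          rw [this]
          refine (enorm_integral_le_lintegral_enorm _).trans_eq ?_
          simp_rw [enorm_mul]
      _ = ∫⁻ y, ∫⁻ x, ‖f (x - t • y) - f x‖ₑ * ‖φ y‖ₑ :=
          lintegral_lintegral_swap (by fun_prop)
      _ = _ := by
          refine lintegral_congr fun y => ?_
          rw [lintegral_mul_const _ (by fun_prop)]
  refine tendsto_of_tendsto_of_tendsto_of_le_of_le tendsto_const_nhds ?_ (fun _ => zero_le) hbound
  have := tendsto_lintegral_filter_of_dominated_convergence (μ := volume) (l := 𝓝 (0 : ℝ))
    (F := fun (t : ℝ) y => (∫⁻ x, ‖f (x - t • y) - f x‖ₑ) * ‖φ y‖ₑ) (f := fun _ => 0)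
    (fun y => ((∫⁻ x, ‖f x‖ₑ) + ∫⁻ x, ‖f x‖ₑ) * ‖φ y‖ₑ) ?_ ?_ ?_ ?_
  · simpa using this
  · refine Eventually.of_forall fun t => ?_
    exact Measurable.mul (Measurable.lintegral_prod_left'
      (f := fun p : (Fin d → ℝ) × (Fin d → ℝ) => ‖f (p.1 - t • p.2) - f p.1‖ₑ) (by fun_prop))
      (by fun_prop)
  · refine Eventually.of_forall fun t => ae_of_all _ fun y => ?_
    gcongr
    calc ∫⁻ x, ‖f (x - t • y) - f x‖ₑ ≤ ∫⁻ x, (‖f (x - t • y)‖ₑ + ‖f x‖ₑ) :=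
          lintegral_mono fun x => enorm_sub_le
      _ = _ := by
          rw [lintegral_add_left (by fun_prop), lintegral_sub_right_eq_self fun x => ‖f x‖ₑ]
  · rw [lintegral_const_mul _ (by fun_prop)]
    exact ENNReal.mul_ne_top (ENNReal.add_ne_top.2 ⟨hf.2.ne, hf.2.ne⟩) hφ.2.ne
  · refine ae_of_all _ fun y => ?_
    have h : Tendsto (fun t : ℝ => t • y) (𝓝 0) (𝓝 0) := by
      simpa using (tendsto_id (x := 𝓝 (0 : ℝ))).smul_const y
    simpa using ENNReal.Tendsto.mul_const
      ((tendsto_lintegral_enorm_sub_translate hf).comp h) (Or.inr enorm_ne_top)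

/-- `f` is a probability density on `ℝ^d`. -/
structure IsProbDensity (f : (Fin d → ℝ) → ℝ) : Prop where
  nonneg : ∀ x, 0 ≤ f x
  integrable : Integrable f
  integral_eq_one : ∫ x, f x = 1

/-- The probability of the unit cube with corner `k` under the density `f`. -/
noncomputable def cellProb (f : (Fin d → ℝ) → ℝ) (k : Fin d → ℤ) : ℝ :=
  (volume.withDensity (fun x => ENNReal.ofReal (f x)) (intFloor d ⁻¹' {k})).toReal

/-- The nonnegative integrand of the divergence of the density `f` from its average over
the unit cubes. -/
noncomputable def cellDivIntegrand (f : (Fin d → ℝ) → ℝ) (x : Fin d → ℝ) : ℝ :=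
  f x * log (f x) - f x * log (cellProb f (intFloor d x)) - f x + cellProb f (intFloor d x)

lemma measurableSet_intFloor_preimage (k : Fin d → ℤ) : MeasurableSet (intFloor d ⁻¹' {k}) :=
  measurable_intFloor (measurableSet_singleton k)

lemma measurable_cellProb_intFloor (f : (Fin d → ℝ) → ℝ) :
    Measurable fun x => cellProb f (intFloor d x) :=
  (measurable_of_countable (cellProb f)).comp measurable_intFloor

lemma cellProb_nonneg (f : (Fin d → ℝ) → ℝ) (k : Fin d → ℤ) : 0 ≤ cellProb f k :=
  ENNReal.toReal_nonneg

namespace IsProbDensity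

variable {f : (Fin d → ℝ) → ℝ}

lemma isProbabilityMeasure (hf : IsProbDensity f) :
    IsProbabilityMeasure (volume.withDensity fun x => ENNReal.ofReal (f x)) := by
  constructor
  rw [withDensity_apply _ MeasurableSet.univ, Measure.restrict_univ,
    ← ofReal_integral_eq_lintegral_ofReal hf.integrable (ae_of_all _ hf.nonneg),
    hf.integral_eq_one, ENNReal.ofReal_one]

lemma ofReal_cellProb (hf : IsProbDensity f) (k : Fin d → ℤ) :
    ENNReal.ofReal (cellProb f k) =
      volume.withDensity (fun x => ENNReal.ofReal (f x)) (intFloor d ⁻¹' {k}) := by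
  have := hf.isProbabilityMeasure
  exact ENNReal.ofReal_toReal (measure_ne_top _ _)

lemma cellProb_le_one (hf : IsProbDensity f) (k : Fin d → ℤ) : cellProb f k ≤ 1 := by
  have := hf.isProbabilityMeasure
  exact measureReal_le_one

lemma cellProb_eq_setIntegral (hf : IsProbDensity f) (k : Fin d → ℤ) :
    cellProb f k = ∫ x in intFloor d ⁻¹' {k}, f x := by
  rw [cellProb, withDensity_apply _ (measurableSet_intFloor_preimage k),
    integral_eq_lintegral_of_nonneg_ae (ae_of_all _ hf.nonneg)
      hf.integrable.aestronglyMeasurable.restrict]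

lemma ae_eq_zero_of_cellProb_eq_zero (hf : IsProbDensity f) :
    ∀ᵐ x, cellProb f (intFloor d x) = 0 → f x = 0 := by
  have h : ∀ k : Fin d → ℤ, ∀ᵐ x, x ∈ intFloor d ⁻¹' {k} → cellProb f k = 0 → f x = 0 := by
    intro k
    by_cases hk : cellProb f k = 0
    · have h0 := hk
      rw [hf.cellProb_eq_setIntegral, integral_eq_zero_iff_of_nonneg hf.nonneg
        hf.integrable.integrableOn] at h0
      filter_upwards [(ae_restrict_iff' (measurableSet_intFloor_preimage k)).1 h0]
        with x hx hxk _ using hx hxk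
    · exact ae_of_all _ fun x _ h0 => absurd h0 hk
  filter_upwards [ae_all_iff.2 h] with x hx using hx _ rfl

lemma lintegral_cellProb (hf : IsProbDensity f) :
    ∫⁻ x, ENNReal.ofReal (cellProb f (intFloor d x)) = 1 := by
  have := hf.isProbabilityMeasure
  rw [lintegral_comp_intFloor volume fun k => ENNReal.ofReal (cellProb f k)]
  simp_rw [volume_intFloor_preimage, mul_one, hf.ofReal_cellProb]
  have h := lintegral_comp_intFloor (volume.withDensity fun x => ENNReal.ofReal (f x)) fun _ => 1
  simpa using h.symm

lemma integrable_cellProb (hf : IsProbDensity f) :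
    Integrable fun x => cellProb f (intFloor d x) := by
  refine ⟨(measurable_cellProb_intFloor f).aestronglyMeasurable, ?_⟩
  rw [hasFiniteIntegral_iff_ofReal (ae_of_all _ fun x => cellProb_nonneg f _),
    hf.lintegral_cellProb]
  exact ENNReal.one_lt_top

lemma integral_cellProb (hf : IsProbDensity f) : ∫ x, cellProb f (intFloor d x) = 1 := by
  rw [integral_eq_lintegral_of_nonneg_ae (ae_of_all _ fun x => cellProb_nonneg f _)
    (measurable_cellProb_intFloor f).aestronglyMeasurable, hf.lintegral_cellProb,
    ENNReal.toReal_one]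

lemma mul_neg_log_cellProb_nonneg (hf : IsProbDensity f) (x : Fin d → ℝ) :
    0 ≤ f x * -log (cellProb f (intFloor d x)) :=
  mul_nonneg (hf.nonneg x)
    (neg_nonneg.2 (log_nonpos (cellProb_nonneg f _) (hf.cellProb_le_one _)))

lemma lintegral_mul_neg_log_cellProb (hf : IsProbDensity f) :
    ∫⁻ x, ENNReal.ofReal (f x * -log (cellProb f (intFloor d x))) =
      discEnt (volume.withDensity fun x => ENNReal.ofReal (f x)) (intFloor d) := by
  have hm : Measurable fun x => ENNReal.ofReal (-log (cellProb f (intFloor d x))) :=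
    (measurable_cellProb_intFloor f).log.neg.ennreal_ofReal
  simp_rw [ENNReal.ofReal_mul (hf.nonneg _)]
  have h := lintegral_withDensity_eq_lintegral_mul₀
    hf.integrable.aestronglyMeasurable.aemeasurable.ennreal_ofReal hm.aemeasurable
  simp only [Pi.mul_apply] at h
  rw [← h, lintegral_comp_intFloor _ fun k => ENNReal.ofReal (-log (cellProb f k)), discEnt]
  refine tsum_congr fun k => ?_
  rw [← hf.ofReal_cellProb, ← ENNReal.ofReal_mul' (cellProb_nonneg f k),
    ENNReal.toReal_ofReal (cellProb_nonneg f k), negMulLog]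
  congr 1
  ring

lemma aestronglyMeasurable_mul_neg_log_cellProb (hf : IsProbDensity f) :
    AEStronglyMeasurable (fun x => f x * -log (cellProb f (intFloor d x))) volume :=
  hf.integrable.aestronglyMeasurable.mul
    (measurable_cellProb_intFloor f).log.neg.aestronglyMeasurable

lemma integrable_mul_neg_log_cellProb (hf : IsProbDensity f)
    (hH : discEnt (volume.withDensity fun x => ENNReal.ofReal (f x)) (intFloor d) ≠ ⊤) :
    Integrable fun x => f x * -log (cellProb f (intFloor d x)) := by
  refine ⟨hf.aestronglyMeasurable_mul_neg_log_cellProb, ?_⟩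
  rw [hasFiniteIntegral_iff_ofReal (ae_of_all _ hf.mul_neg_log_cellProb_nonneg),
    hf.lintegral_mul_neg_log_cellProb]
  exact hH.lt_top

lemma integral_mul_neg_log_cellProb (hf : IsProbDensity f) :
    ∫ x, f x * -log (cellProb f (intFloor d x)) =
      (discEnt (volume.withDensity fun x => ENNReal.ofReal (f x)) (intFloor d)).toReal := by
  rw [integral_eq_lintegral_of_nonneg_ae (ae_of_all _ hf.mul_neg_log_cellProb_nonneg)
    hf.aestronglyMeasurable_mul_neg_log_cellProb, hf.lintegral_mul_neg_log_cellProb]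

lemma diffEnt_eq (hf : IsProbDensity f) :
    diffEnt (volume.withDensity fun x => ENNReal.ofReal (f x)) = -∫ x, f x * log (f x) := by
  unfold diffEnt
  congr 1
  refine integral_congr_ae ?_
  filter_upwards [Measure.rnDeriv_withDensity₀ volume
    hf.integrable.aestronglyMeasurable.aemeasurable.ennreal_ofReal] with x hx
  rw [hx, ENNReal.toReal_ofReal (hf.nonneg x)]

lemma cellDivIntegrand_nonneg (hf : IsProbDensity f) : ∀ᵐ x, 0 ≤ cellDivIntegrand f x := by
  filter_upwards [hf.ae_eq_zero_of_cellProb_eq_zero] with x hx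
  unfold cellDivIntegrand
  rcases (hf.nonneg x).eq_or_lt with h0 | h0
  · simp [← h0, cellProb_nonneg]
  · have hp : 0 < cellProb f (intFloor d x) :=
      (cellProb_nonneg f _).lt_of_ne fun h => h0.ne' (hx h.symm)
    have h1 := mul_le_mul_of_nonneg_left (log_le_sub_one_of_pos (div_pos hp h0)) h0.le
    rw [log_div hp.ne' h0.ne', mul_sub, mul_sub, mul_div_cancel₀ _ h0.ne'] at h1
    linarith

lemma integrable_mul_log (hf : IsProbDensity f)
    (hH : discEnt (volume.withDensity fun x => ENNReal.ofReal (f x)) (intFloor d) ≠ ⊤)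
    {C : ℝ} (hC : ∀ x, f x ≤ C) : Integrable fun x => f x * log (f x) := by
  have hu := hf.integrable_mul_neg_log_cellProb hH
  refine Integrable.mono' ((hu.add hf.integrable_cellProb).add (hf.integrable.mul_const |log C|))
    (hf.integrable.aestronglyMeasurable.mul
      (measurable_log.comp_aemeasurable
        hf.integrable.aestronglyMeasurable.aemeasurable).aestronglyMeasurable) ?_
  filter_upwards [hf.cellDivIntegrand_nonneg] with x hx
  unfold cellDivIntegrand at hx
  have h0 := hf.nonneg x
  have hup : f x * log (f x) ≤ f x * |log C| := by
    rcases h0.eq_or_lt with h | h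
    · simp [← h]
    · exact mul_le_mul_of_nonneg_left ((log_le_log h (hC x)).trans (le_abs_self _)) h0
  have h1 := hf.mul_neg_log_cellProb_nonneg x
  have h2 := cellProb_nonneg f (intFloor d x)
  have h3 : 0 ≤ f x * |log C| := by positivity
  simp only [Pi.add_apply]
  rw [norm_eq_abs, abs_le]
  constructor <;> linarith

lemma discEnt_sub_diffEnt (hf : IsProbDensity f)
    (hH : discEnt (volume.withDensity fun x => ENNReal.ofReal (f x)) (intFloor d) ≠ ⊤)
    (hent : Integrable fun x => f x * log (f x)) :
    (discEnt (volume.withDensity fun x => ENNReal.ofReal (f x)) (intFloor d) : EReal)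
      - ((diffEnt (volume.withDensity fun x => ENNReal.ofReal (f x)) : ℝ) : EReal)
      = ((∫⁻ x, ENNReal.ofReal (cellDivIntegrand f x) : ℝ≥0∞) : EReal) := by
  have hu := hf.integrable_mul_neg_log_cellProb hH
  have heq : cellDivIntegrand f = (fun x => f x * log (f x)) +
      (fun x => f x * -log (cellProb f (intFloor d x))) - f +
      fun x => cellProb f (intFloor d x) := by
    ext x
    simp only [cellDivIntegrand, Pi.add_apply, Pi.sub_apply]
    ring
  have hint : Integrable (cellDivIntegrand f) := by
    rw [heq]
    exact ((hent.add hu).sub hf.integrable).add hf.integrable_cellProb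
  have hval : ∫ x, cellDivIntegrand f x =
      (discEnt (volume.withDensity fun x => ENNReal.ofReal (f x)) (intFloor d)).toReal
        - diffEnt (volume.withDensity fun x => ENNReal.ofReal (f x)) := by
    rw [heq, integral_add' ((hent.add hu).sub hf.integrable) hf.integrable_cellProb,
      integral_sub' (hent.add hu) hf.integrable, integral_add' hent hu, hf.integral_cellProb,
      hf.integral_eq_one, hf.integral_mul_neg_log_cellProb, hf.diffEnt_eq]
    ring
  rw [← ofReal_integral_eq_lintegral_ofReal hint hf.cellDivIntegrand_nonneg,
    EReal.coe_ennreal_ofReal, max_eq_left (integral_nonneg_of_ae hf.cellDivIntegrand_nonneg), hval,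
    EReal.coe_sub, EReal.coe_ennreal_toReal hH]

lemma lintegral_cellDivIntegrand_le_liminf (hf : IsProbDensity f) {g : ℕ → (Fin d → ℝ) → ℝ}
    (hg : ∀ n, IsProbDensity (g n))
    (hL1 : Tendsto (fun n => ∫⁻ x, ‖g n x - f x‖ₑ) atTop (𝓝 0))
    (hae : ∀ᵐ x, Tendsto (fun n => g n x) atTop (𝓝 (f x))) :
    ∫⁻ x, ENNReal.ofReal (cellDivIntegrand f x) ≤
      liminf (fun n => ∫⁻ x, ENNReal.ofReal (cellDivIntegrand (g n) x)) atTop := by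
  have hp : ∀ k, Tendsto (fun n => cellProb (g n) k) atTop (𝓝 (cellProb f k)) := by
    intro k
    simp_rw [(hg _).cellProb_eq_setIntegral, hf.cellProb_eq_setIntegral]
    exact tendsto_setIntegral_of_L1 f hf.integrable.aestronglyMeasurable
      (Eventually.of_forall fun n => (hg n).integrable) hL1 _
  refine le_trans (lintegral_mono_ae ?_) (lintegral_liminf_le' fun n => ?_)
  · filter_upwards [hf.ae_eq_zero_of_cellProb_eq_zero, hae] with x hx hxt
    by_cases h0 : cellProb f (intFloor d x) = 0
    · simp [cellDivIntegrand, hx h0, h0]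
    · refine (Tendsto.liminf_eq ?_).ge
      refine (ENNReal.continuous_ofReal.tendsto _).comp ?_
      refine Tendsto.add (Tendsto.sub (Tendsto.sub ?_ ?_) hxt) (hp _)
      · exact (continuous_mul_log.tendsto _).comp hxt
      · exact hxt.mul ((hp _).log h0)
  · have hm : AEMeasurable (g n) volume := (hg n).integrable.aestronglyMeasurable.aemeasurable
    have hc := measurable_cellProb_intFloor (g n)
    exact ((((hm.mul (measurable_log.comp_aemeasurable hm)).sub
      (hm.mul hc.log.aemeasurable)).sub hm).add hc.aemeasurable).ennreal_ofReal

end IsProbDensity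

lemma IsProbDensity.mollify {φ f : (Fin d → ℝ) → ℝ} (hφ : IsProbDensity φ) (hφm : Measurable φ)
    (hf : IsProbDensity f) (hfm : Measurable f) (t : ℝ) : IsProbDensity (mollify φ f t) where
  nonneg x := integral_nonneg fun y => mul_nonneg (hf.nonneg _) (hφ.nonneg y)
  integrable := integrable_mollify hφ.integrable hφm hf.integrable hfm t
  integral_eq_one := by
    rw [integral_mollify hφ.integrable hφm hf.integrable hfm, hf.integral_eq_one,
      hφ.integral_eq_one, one_mul]

lemma mollify_inv_eq (φ f : (Fin d → ℝ) → ℝ) {s : ℝ} (hs : 0 < s) (x : Fin d → ℝ) :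
    mollify φ f s⁻¹ x = ∫ y, f (x - y) * (s ^ d * φ (s • y)) := by
  have h := Measure.integral_comp_smul volume (fun y => f (x - s⁻¹ • y) * φ y) s
  simp only [inv_smul_smul₀ hs.ne', Module.finrank_fin_fun, smul_eq_mul] at h
  simp_rw [mul_left_comm _ (s ^ d)]
  rw [integral_const_mul, h, abs_of_pos (by positivity), mul_inv_cancel_left₀ (by positivity),
    _root_.mollify]

lemma mollify_le {φ f : (Fin d → ℝ) → ℝ} (hφ : IsProbDensity φ) (hf : IsProbDensity f) {K : ℝ}
    (hK : ∀ y, φ y ≤ K) {s : ℝ} (hs : 0 < s) (x : Fin d → ℝ) :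
    mollify φ f s⁻¹ x ≤ s ^ d * K := by
  rw [mollify_inv_eq φ f hs]
  calc ∫ y, f (x - y) * (s ^ d * φ (s • y)) ≤ ∫ y, f (x - y) * (s ^ d * K) := by
        refine integral_mono_of_nonneg
          (ae_of_all _ fun y => mul_nonneg (hf.nonneg _) (mul_nonneg (by positivity) (hφ.nonneg _)))
          ((hf.integrable.comp_sub_left x).mul_const _) (ae_of_all _ fun y => ?_)
        have := hf.nonneg (x - y)
        dsimp only
        gcongr
        exact hK _
    _ = s ^ d * K := by
        rw [integral_mul_const, integral_sub_left_eq_self f, hf.integral_eq_one, one_mul]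

/-- Floor entropy minus differential entropy is lower semicontinuous along mollifications. -/
lemma le_liminf_discEnt_sub_diffEnt_mollify {φ f : (Fin d → ℝ) → ℝ} (hφ : IsProbDensity φ)
    (hφm : Measurable φ) {K : ℝ} (hK : ∀ y, φ y ≤ K) (hf : IsProbDensity f) (hfm : Measurable f)
    (hent : Integrable fun x => f x * log (f x))
    (hH : discEnt (volume.withDensity fun x => ENNReal.ofReal (f x)) (intFloor d) ≠ ⊤)
    {ι : Type*} {l : Filter ι} [l.IsCountablyGenerated] {s : ι → ℝ} (hs : Tendsto s l atTop)
    {g : ι → (Fin d → ℝ) → ℝ} (hg : ∀ᶠ i in l, g i = mollify φ f (s i)⁻¹) :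
    (discEnt (volume.withDensity fun x => ENNReal.ofReal (f x)) (intFloor d) : EReal)
        - ((diffEnt (volume.withDensity fun x => ENNReal.ofReal (f x)) : ℝ) : EReal) ≤
      liminf (fun i =>
        (discEnt (volume.withDensity fun x => ENNReal.ofReal (g i x)) (intFloor d) : EReal)
          - ((diffEnt (volume.withDensity fun x => ENNReal.ofReal (g i x)) : ℝ) : EReal)) l := by
  rw [hf.discEnt_sub_diffEnt hH hent]
  by_contra! hlt
  obtain ⟨b, hb, hbf⟩ := exists_between hlt
  obtain ⟨u, hu, hub⟩ := exists_seq_forall_of_frequently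
    ((frequently_lt_of_liminf_lt (by isBoundedDefault) hb).and_eventually
      (hg.and (hs.eventually_gt_atTop 0)))
  have hgd : ∀ n, IsProbDensity (g (u n)) := fun n => by
    rw [(hub n).2.1]
    exact hφ.mollify hφm hf hfm _
  have hle : ∀ n, ((∫⁻ x, ENNReal.ofReal (cellDivIntegrand (g (u n)) x) : ℝ≥0∞) : EReal) ≤ b := by
    intro n
    obtain ⟨h1, h2, h3⟩ := hub n
    by_cases hn : discEnt (volume.withDensity fun x => ENNReal.ofReal (g (u n) x)) (intFloor d) = ⊤
    · rw [hn, EReal.coe_ennreal_top, EReal.top_sub_coe] at h1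
      exact absurd h1 not_top_lt
    · rw [(hgd n).discEnt_sub_diffEnt hn ((hgd n).integrable_mul_log hn
        (C := s (u n) ^ d * K) fun x => by rw [h2]; exact mollify_le hφ hf hK h3 x)] at h1
      exact h1.le
  have hb0 : 0 ≤ b := (EReal.coe_ennreal_nonneg _).trans (hle 0)
  have hle' : ∀ n, ∫⁻ x, ENNReal.ofReal (cellDivIntegrand (g (u n)) x) ≤ b.toENNReal := by
    intro n
    rw [← EReal.coe_ennreal_le_coe_ennreal_iff, EReal.coe_toENNReal hb0]
    exact hle n
  have hL1 : Tendsto (fun n => ∫⁻ x, ‖g (u n) x - f x‖ₑ) atTop (𝓝 0) := by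
    refine ((tendsto_lintegral_enorm_mollify_sub hφ.integrable hφm hφ.integral_eq_one
      hf.integrable hfm).comp (tendsto_inv_atTop_zero.comp (hs.comp hu))).congr fun n => ?_
    rw [(hub n).2.1]
    rfl
  obtain ⟨v, hv, hvae⟩ := (tendstoInMeasure_of_tendsto_eLpNorm (p := 1) one_ne_zero
    (fun n => (hgd n).integrable.aestronglyMeasurable) hf.integrable.aestronglyMeasurable
    (by simpa only [eLpNorm_one_eq_lintegral_enorm, Pi.sub_apply] using hL1)).exists_seq_tendsto_ae
  have hfatou := hf.lintegral_cellDivIntegrand_le_liminf (fun n => hgd (v n))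
    (hL1.comp hv.tendsto_atTop) hvae
  have hfin := hfatou.trans (liminf_le_of_le (by isBoundedDefault) fun c hc =>
    hc.exists.choose_spec.trans (hle' _))
  rw [← EReal.coe_ennreal_le_coe_ennreal_iff, EReal.coe_toENNReal hb0] at hfin
  exact hbf.not_ge hfin

lemma integral_exp_neg_seminorm_rpow (hd : 1 ≤ d) {r : ℝ} (hr : 0 < r)
    (ν : Seminorm ℝ (Fin d → ℝ)) (hνdef : ∀ x, ν x = 0 → x = 0) (hνcont : Continuous fun x => ν x) :
    0 < ∫ x, exp (-ν x ^ r) ∧ ∫ x, exp (-ν x ^ r) =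
      (volume {x : Fin d → ℝ | ν x ≤ 1}).toReal * (d / r * Gamma (d / r)) := by
  have : Nonempty (Fin d) := ⟨⟨0, hd⟩⟩
  have hdr : 0 < (d : ℝ) / r := by positivity
  have hG : 0 < (d : ℝ) / r * Gamma (d / r) := mul_pos hdr (Gamma_pos_of_pos hdr)
  have h1 := measure_lt_one_eq_integral_div_gamma (volume : Measure (Fin d → ℝ)) (g := ν)
    (map_zero ν) (map_neg_eq_map ν) (map_add_le_add ν) (hνdef _)
    (fun c x => (map_smul_eq_mul ν c x).le) hr
  have h2 := measure_le_eq_lt (volume : Measure (Fin d → ℝ)) (g := ν)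
    (map_zero ν) (map_neg_eq_map ν) (map_add_le_add ν) (hνdef _)
    (fun c x => (map_smul_eq_mul ν c x).le) 1
  rw [Module.finrank_fin_fun, Gamma_add_one hdr.ne'] at h1
  have hpos : 0 < volume {x : Fin d → ℝ | ν x < 1} :=
    (isOpen_lt hνcont continuous_const).measure_pos _ ⟨0, by simp⟩
  rw [h1, ENNReal.ofReal_pos, div_pos_iff_of_pos_right hG] at hpos
  refine ⟨hpos, ?_⟩
  rw [h2, h1, ENNReal.toReal_ofReal (by positivity), div_mul_cancel₀ _ hG.ne']

/-- The generalized Gaussian density associated with the seminorm `ν`, at unit scale. -/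
noncomputable def seminormExpDensity (ν : Seminorm ℝ (Fin d → ℝ)) (r : ℝ) (x : Fin d → ℝ) : ℝ :=
  exp (-ν x ^ r) / ∫ z, exp (-ν z ^ r)

lemma seminormExpDensity_le (ν : Seminorm ℝ (Fin d → ℝ)) (r : ℝ) (x : Fin d → ℝ) :
    seminormExpDensity ν r x ≤ 1 / ∫ z, exp (-ν z ^ r) := by
  have : 0 ≤ ∫ z, exp (-ν z ^ r) := integral_nonneg fun z => (exp_pos _).le
  unfold seminormExpDensity
  gcongr
  exact exp_le_one_iff.2 (neg_nonpos.2 (rpow_nonneg (apply_nonneg ν x) r))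

lemma isProbDensity_seminormExpDensity {ν : Seminorm ℝ (Fin d → ℝ)} {r : ℝ}
    (hI : 0 < ∫ x, exp (-ν x ^ r)) : IsProbDensity (seminormExpDensity ν r) where
  nonneg x := div_nonneg (exp_pos _).le hI.le
  integrable := (Integrable.of_integral_ne_zero hI.ne').div_const _
  integral_eq_one := by
    unfold seminormExpDensity
    rw [integral_div, div_self hI.ne']

lemma genGaussian_eq_rescaled_seminormExpDensity (hd : 1 ≤ d) {r : ℝ} (hr : 0 < r)
    (ν : Seminorm ℝ (Fin d → ℝ)) (hνdef : ∀ x, ν x = 0 → x = 0) (hνcont : Continuous fun x => ν x)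
    {D : ℝ} (hD : 0 < D) (z : Fin d → ℝ) :
    ((d : ℝ) / r) ^ ((d : ℝ) / r - 1) *
        ((volume {x : Fin d → ℝ | ν x ≤ 1}).toReal * Gamma ((d : ℝ) / r) * D ^ ((d : ℝ) / r))⁻¹ *
        exp (-((d : ℝ) / (r * D)) * ν z ^ r) =
      (((d : ℝ) / (r * D)) ^ r⁻¹) ^ d *
        seminormExpDensity ν r (((d : ℝ) / (r * D)) ^ r⁻¹ • z) := by
  have hd0 : (0 : ℝ) < d := by exact_mod_cast hd
  obtain ⟨hI, hIeq⟩ := integral_exp_neg_seminorm_rpow hd hr ν hνdef hνcont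
  have hc : 0 < (d : ℝ) / (r * D) := by positivity
  have hdr : 0 < (d : ℝ) / r := by positivity
  have hG := Gamma_pos_of_pos hdr
  have hV : (volume {x : Fin d → ℝ | ν x ≤ 1}).toReal ≠ 0 := by
    intro h
    rw [hIeq, h, zero_mul] at hI
    exact hI.false
  rw [seminormExpDensity, map_smul_eq_mul, norm_of_nonneg (by positivity),
    mul_rpow (by positivity) (apply_nonneg ν z), ← rpow_mul hc.le, inv_mul_cancel₀ hr.ne', rpow_one,
    ← rpow_natCast, ← rpow_mul hc.le, inv_mul_eq_div, ← div_div (d : ℝ) r D,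
    div_rpow hdr.le hD.le, rpow_sub_one hdr.ne', hIeq]
  have := (rpow_pos_of_pos hD ((d : ℝ) / r)).ne'
  field_simp

end Auxiliary

/-- `liminf_{D↓0} { H(⌊X+Z_D⌋) − h(X+Z_D) } ≥ H(⌊X⌋) − h(X)`, where `Z_D` is the
generalized-Gaussian noise of distortion `D`, independent of `X`, so that `X+Z_D`
has density the convolution of `f_X` and `f_{Z_D}`. -/
theorem liminf_floorEntropy_sub_diffEnt
    (d : ℕ) (hd : 1 ≤ d) (r : ℝ) (hr : 0 < r)
    (ν : Seminorm ℝ (Fin d → ℝ)) (hνdef : ∀ x, ν x = 0 → x = 0)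
    (hνcont : Continuous fun x => ν x)
    (fX : (Fin d → ℝ) → ℝ) (hf0 : ∀ x, 0 ≤ fX x) (hfm : Measurable fX)
    (hprob : ∫ x, fX x = 1)
    (hent : Integrable (fun x => fX x * Real.log (fX x)) volume)
    (hH : discEnt (volume.withDensity fun x => ENNReal.ofReal (fX x)) (intFloor d) ≠ ⊤) :
    ∀ Vd : ℝ, Vd = (volume {x : Fin d → ℝ | ν x ≤ 1}).toReal →
    ∀ fZ : ℝ → (Fin d → ℝ) → ℝ, (∀ D z, fZ D z =
      ((d : ℝ) / r) ^ ((d : ℝ) / r - 1) *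
        (Vd * Real.Gamma ((d : ℝ) / r) * D ^ ((d : ℝ) / r))⁻¹ *
        Real.exp (-((d : ℝ) / (r * D)) * ν z ^ r)) →
    -- `g D` is the density of `X + Z_D`: the convolution of `fX` and `fZ D`
    ∀ g : ℝ → (Fin d → ℝ) → ℝ, (∀ D x, g D x = ∫ y, fX (x - y) * fZ D y) →
    Filter.liminf
        (fun D : ℝ =>
          ((discEnt (volume.withDensity fun x => ENNReal.ofReal (g D x)) (intFloor d) : EReal)
            - ((diffEnt (volume.withDensity fun x => ENNReal.ofReal (g D x)) : ℝ) : EReal)))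
        (𝓝[>] (0 : ℝ)) ≥
      ((discEnt (volume.withDensity fun x => ENNReal.ofReal (fX x)) (intFloor d) : EReal)
        - ((diffEnt (volume.withDensity fun x => ENNReal.ofReal (fX x)) : ℝ) : EReal)) := by
  rintro Vd rfl fZ hfZ g hg
  obtain ⟨hI, -⟩ := integral_exp_neg_seminorm_rpow hd hr ν hνdef hνcont
  have hd0 : (0 : ℝ) < d := by exact_mod_cast hd
  have hφm : Measurable (seminormExpDensity ν r) :=
    ((hνcont.measurable.pow_const r).neg.exp).div_const _
  have hs : Tendsto (fun D : ℝ => ((d : ℝ) / (r * D)) ^ r⁻¹) (𝓝[>] 0) atTop := by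
    refine (tendsto_rpow_atTop (inv_pos.2 hr)).comp ?_
    simp_rw [← div_div, div_eq_mul_inv _ (_ : ℝ)]
    exact tendsto_inv_nhdsGT_zero.const_mul_atTop (by positivity)
  refine le_liminf_discEnt_sub_diffEnt_mollify (isProbDensity_seminormExpDensity hI) hφm
    (seminormExpDensity_le ν r)
    ⟨hf0, Integrable.of_integral_ne_zero (by simp [hprob]), hprob⟩ hfm hent hH hs ?_
  filter_upwards [self_mem_nhdsWithin] with D (hD : 0 < D)
  ext x
  rw [hg, mollify_inv_eq _ _ (by positivity)]
  simp_rw [hfZ, genGaussian_eq_rescaled_seminormExpDensity hd hr ν hνdef hνcont hD]
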